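/- Let ψ, ψ′ : Fin 2 → Fin 2 → Fin 2 → Fin 2 → ℂ be four-qubit tensors with associated matrices R(ψ) = T ψ̃ T† and R(ψ′) = T ψ̃′ T†. Then there exist U₁, U₂, U₃, U₄ ∈ SU(2) with ψ′ = (U₁⊗U₂⊗U₃⊗U₄) ψ if and only if there exist real special orthogonal 4×4 matrices O₁, O₂ ∈ SO(4,ℝ) (regarded as complex matrices) with R(ψ′) = O₁ R(ψ) O₂. Hence two four-qubit pure states are equivalent under local unitary operations (with determinant-1 local unitaries) exactly when their R-matrices lie in the same SO(4,ℝ)×SO(4,ℝ) orbit. -/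

import Mathlib

open Matrix

noncomputable section

/-- The fixed matrix `T = (1/√2)·[[1,0,0,1],[0,i,i,0],[0,-1,1,0],[i,0,0,-i]]`. -/
noncomputable def Tmat : Matrix (Fin 4) (Fin 4) ℂ :=
  ((1 / Real.sqrt 2 : ℝ) : ℂ) •
    !![1, 0, 0, 1;
       0, Complex.I, Complex.I, 0;
       0, -1, 1, 0;
       Complex.I, 0, 0, -Complex.I]

/-- The index identification `(i,j) ↦ 2i+j` between `Fin 2 × Fin 2` (ordered 00,01,10,11)
and `Fin 4`. -/
def qIdx : Fin 2 × Fin 2 ≃ Fin 4 where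
  toFun p := ⟨2 * p.1.val + p.2.val, by have h1 := p.1.isLt; have h2 := p.2.isLt; omega⟩
  invFun k := (⟨k.val / 2, by have := k.isLt; omega⟩, ⟨k.val % 2, by have := k.isLt; omega⟩)
  left_inv := by decide
  right_inv := by decide

/-- Kronecker product of two `2×2` matrices as a `4×4` matrix (basis ordered 00,01,10,11). -/
def kron (A B : Matrix (Fin 2) (Fin 2) ℂ) : Matrix (Fin 4) (Fin 4) ℂ :=
  fun r c => A (qIdx.symm r).1 (qIdx.symm c).1 * B (qIdx.symm r).2 (qIdx.symm c).2

/-- The reshaping `ψ̃` of a four-qubit tensor into a `4×4` matrix, with row index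
`(i₁,i₂)` and column index `(i₃,i₄)`, bases ordered 00,01,10,11. -/
def reshape (ψ : Fin 2 → Fin 2 → Fin 2 → Fin 2 → ℂ) : Matrix (Fin 4) (Fin 4) ℂ :=
  fun r c => ψ (qIdx.symm r).1 (qIdx.symm r).2 (qIdx.symm c).1 (qIdx.symm c).2

/-- The matrix `R(ψ) = T ψ̃ T†`. -/
noncomputable def Rmat (ψ : Fin 2 → Fin 2 → Fin 2 → Fin 2 → ℂ) : Matrix (Fin 4) (Fin 4) ℂ :=
  Tmat * reshape ψ * Tmatᴴ

/-- The action of `A₁ ⊗ A₂ ⊗ A₃ ⊗ A₄` on a four-qubit tensor. -/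
def act (A₁ A₂ A₃ A₄ : Matrix (Fin 2) (Fin 2) ℂ) (ψ : Fin 2 → Fin 2 → Fin 2 → Fin 2 → ℂ) :
    Fin 2 → Fin 2 → Fin 2 → Fin 2 → ℂ :=
  fun i₁ i₂ i₃ i₄ => ∑ j₁, ∑ j₂, ∑ j₃, ∑ j₄,
    A₁ i₁ j₁ * A₂ i₂ j₂ * A₃ i₃ j₃ * A₄ i₄ j₄ * ψ j₁ j₂ j₃ j₄

open scoped Quaternion Kronecker RealInnerProductSpace

theorem kron_eq_submatrix_kronecker (A B : Matrix (Fin 2) (Fin 2) ℂ) :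
    kron A B = (A ⊗ₖ B).submatrix qIdx.symm qIdx.symm :=
  rfl

theorem kron_of (a b c d a' b' c' d' : ℂ) :
    kron !![a, b; c, d] !![a', b'; c', d'] =
      !![a * a', a * b', b * a', b * b';
         a * c', a * d', b * c', b * d';
         c * a', c * b', d * a', d * b';
         c * c', c * d', d * c', d * d'] := by
  ext i j
  fin_cases i <;> fin_cases j <;> rfl

theorem kron_mul_kron (A B C D : Matrix (Fin 2) (Fin 2) ℂ) :
    kron A B * kron C D = kron (A * C) (B * D) := by
  simp only [kron_eq_submatrix_kronecker, Matrix.submatrix_mul_equiv, Matrix.mul_kronecker_mul]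

theorem kron_one_one : kron 1 1 = 1 := by
  simp [kron_eq_submatrix_kronecker]

theorem kron_conjTranspose (A B : Matrix (Fin 2) (Fin 2) ℂ) : (kron A B)ᴴ = kron Aᴴ Bᴴ := by
  simp only [kron_eq_submatrix_kronecker, Matrix.conjTranspose_submatrix,
    Matrix.conjTranspose_kronecker]

theorem kron_transpose (A B : Matrix (Fin 2) (Fin 2) ℂ) : (kron A B)ᵀ = kron Aᵀ Bᵀ :=
  rfl

theorem det_kron (A B : Matrix (Fin 2) (Fin 2) ℂ) : (kron A B).det = A.det ^ 2 * B.det ^ 2 := by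
  simp [kron_eq_submatrix_kronecker, Matrix.det_submatrix_equiv_self, Matrix.det_kronecker]

theorem reshape_act (A₁ A₂ A₃ A₄ : Matrix (Fin 2) (Fin 2) ℂ)
    (ψ : Fin 2 → Fin 2 → Fin 2 → Fin 2 → ℂ) :
    reshape (act A₁ A₂ A₃ A₄ ψ) = kron A₁ A₂ * reshape ψ * (kron A₃ A₄)ᵀ := by
  ext r c
  simp only [reshape, act, kron, Matrix.mul_apply, Matrix.transpose_apply,
    ← qIdx.sum_comp, Equiv.symm_apply_apply, Fintype.sum_prod_type, Fin.sum_univ_two]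
  ring

theorem reshape_injective : Function.Injective reshape := by
  intro ψ φ h
  funext i j k l
  simpa [reshape] using congr_fun₂ h (qIdx (i, j)) (qIdx (k, l))

theorem ofReal_inv_sqrt_two_mul_self :
    ((1 / Real.sqrt 2 : ℝ) : ℂ) * ((1 / Real.sqrt 2 : ℝ) : ℂ) = 1 / 2 := by
  rw [← Complex.ofReal_mul, div_mul_div_comm, Real.mul_self_sqrt zero_le_two]
  norm_num

theorem conjTranspose_transpose_mul_transpose {U : Matrix (Fin 2) (Fin 2) ℂ} (hU : Uᴴ * U = 1) :
    Uᵀᴴ * Uᵀ = 1 := by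
  rw [show Uᵀᴴ = Uᴴᵀ from rfl, ← Matrix.transpose_mul, mul_eq_one_comm.mp hU,
    Matrix.transpose_one]

/-- The matrix `Tmat` without its normalising factor `1 / √2`. -/
def TmatCore : Matrix (Fin 4) (Fin 4) ℂ :=
  !![1, 0, 0, 1;
     0, Complex.I, Complex.I, 0;
     0, -1, 1, 0;
     Complex.I, 0, 0, -Complex.I]

theorem TmatCore_conjTranspose : TmatCoreᴴ =
    !![1, 0, 0, -Complex.I;
       0, -Complex.I, -1, 0;
       0, -Complex.I, 1, 0;
       1, 0, 0, Complex.I] := by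
  ext i j
  fin_cases i <;> fin_cases j <;> simp [TmatCore]

theorem Tmat_mul_mul_conjTranspose (M : Matrix (Fin 4) (Fin 4) ℂ) :
    Tmat * M * Tmatᴴ = (1 / 2 : ℂ) • (TmatCore * M * TmatCoreᴴ) := by
  have h : Tmat = ((1 / Real.sqrt 2 : ℝ) : ℂ) • TmatCore := rfl
  rw [h, Matrix.conjTranspose_smul, Complex.star_def, Complex.conj_ofReal, Matrix.smul_mul,
    Matrix.smul_mul, Matrix.mul_smul, smul_smul, ofReal_inv_sqrt_two_mul_self]

theorem Tmat_mul_conjTranspose : Tmat * Tmatᴴ = 1 := by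
  have h := Tmat_mul_mul_conjTranspose 1
  rw [Matrix.mul_one, Matrix.mul_one, TmatCore_conjTranspose] at h
  rw [h]
  ext i j
  fin_cases i <;> fin_cases j <;> simp [TmatCore] <;> norm_num

theorem Tmat_conjTranspose_mul : Tmatᴴ * Tmat = 1 :=
  mul_eq_one_comm.mp Tmat_mul_conjTranspose

theorem Tmat_conj_mul (M N : Matrix (Fin 4) (Fin 4) ℂ) :
    Tmat * (M * N) * Tmatᴴ = Tmat * M * Tmatᴴ * (Tmat * N * Tmatᴴ) := by
  simp only [Matrix.mul_assoc]
  rw [← Matrix.mul_assoc Tmatᴴ Tmat, Tmat_conjTranspose_mul, Matrix.one_mul]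

theorem Tmat_conj_injective :
    Function.Injective fun M : Matrix (Fin 4) (Fin 4) ℂ => Tmat * M * Tmatᴴ := by
  refine Function.LeftInverse.injective (g := fun M => Tmatᴴ * M * Tmat) fun M => ?_
  simp only [Matrix.mul_assoc, Tmat_conjTranspose_mul, Matrix.mul_one]
  rw [← Matrix.mul_assoc, Tmat_conjTranspose_mul, Matrix.one_mul]

/-- The `2 × 2` complex matrix of a real quaternion. -/
def quaternionMatrix (q : ℍ[ℝ]) : Matrix (Fin 2) (Fin 2) ℂ :=
  !![⟨q.re, -q.imK⟩, ⟨-q.imJ, -q.imI⟩;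
     ⟨q.imJ, -q.imI⟩, ⟨q.re, q.imK⟩]

theorem Quaternion.sq_sum_eq_one_of_norm {q : ℍ[ℝ]} (hq : ‖q‖ = 1) :
    q.re ^ 2 + q.imI ^ 2 + q.imJ ^ 2 + q.imK ^ 2 = 1 := by
  rw [← Quaternion.normSq_def', Quaternion.normSq_eq_norm_mul_self, hq, one_mul]

theorem quaternionMatrix_conjTranspose_mul {q : ℍ[ℝ]} (hq : ‖q‖ = 1) :
    (quaternionMatrix q)ᴴ * quaternionMatrix q = 1 := by
  have h := Quaternion.sq_sum_eq_one_of_norm hq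
  ext i j
  fin_cases i <;> fin_cases j <;>
    simp [quaternionMatrix, Matrix.mul_apply, Fin.sum_univ_two, Complex.ext_iff] <;>
    grind

theorem det_quaternionMatrix {q : ℍ[ℝ]} (hq : ‖q‖ = 1) : (quaternionMatrix q).det = 1 := by
  have h := Quaternion.sq_sum_eq_one_of_norm hq
  simp [quaternionMatrix, Matrix.det_fin_two, Complex.ext_iff]
  grind

theorem exists_quaternionMatrix_eq {U : Matrix (Fin 2) (Fin 2) ℂ} (hU : Uᴴ * U = 1)
    (hdet : U.det = 1) : ∃ q : ℍ[ℝ], ‖q‖ = 1 ∧ quaternionMatrix q = U := by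
  have hadj : Uᴴ = U.adjugate := by
    calc Uᴴ = Uᴴ * (U * U.adjugate) := by rw [Matrix.mul_adjugate, hdet, one_smul, Matrix.mul_one]
      _ = U.adjugate := by rw [← Matrix.mul_assoc, hU, Matrix.one_mul]
  have h₀ := congr_fun₂ hadj 1 1
  have h₁ := congr_fun₂ hadj 0 1
  simp only [Matrix.conjTranspose_apply, Matrix.adjugate_fin_two, Complex.ext_iff] at h₀ h₁
  simp at h₀ h₁
  have hn : (U 0 0).re ^ 2 + (U 1 0).im ^ 2 + (U 1 0).re ^ 2 + (U 0 0).im ^ 2 = 1 := by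
    have h₂ := congr_arg Complex.re hdet
    simp [Matrix.det_fin_two] at h₂
    grind
  refine ⟨⟨(U 0 0).re, -(U 1 0).im, (U 1 0).re, -(U 0 0).im⟩, ?_, ?_⟩
  · refine (sq_eq_sq₀ (norm_nonneg _) zero_le_one).mp ?_
    refine (sq _).trans ((Quaternion.normSq_eq_norm_mul_self _).symm.trans
      ((Quaternion.normSq_def' _).trans ?_))
    simpa using hn
  ext i j
  fin_cases i <;> fin_cases j <;> simp [quaternionMatrix, Complex.ext_iff] <;> grind

/-- The basis `1, i, j, k` of the real quaternions. -/
def quaternionBasis : Module.Basis (Fin 4) ℝ ℍ[ℝ] :=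
  QuaternionAlgebra.basisOneIJK (-1) 0 (-1)

theorem quaternionBasis_repr (q : ℍ[ℝ]) (i : Fin 4) :
    quaternionBasis.repr q i = ![q.re, q.imI, q.imJ, q.imK] i :=
  rfl

theorem quaternionBasis_components (j : Fin 4) :
    (quaternionBasis j).re = (Pi.single 0 1 : Fin 4 → ℝ) j ∧
    (quaternionBasis j).imI = (Pi.single 1 1 : Fin 4 → ℝ) j ∧
    (quaternionBasis j).imJ = (Pi.single 2 1 : Fin 4 → ℝ) j ∧
    (quaternionBasis j).imK = (Pi.single 3 1 : Fin 4 → ℝ) j := by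
  have h (i : Fin 4) : quaternionBasis.repr (quaternionBasis j) i =
      (Pi.single i 1 : Fin 4 → ℝ) j := by
    rw [Module.Basis.repr_self, Finsupp.single_apply, Pi.single_apply]
  exact ⟨h 0, h 1, h 2, h 3⟩

/-- The real matrix of `x ↦ p * x * r` on the quaternions in the basis `1, i, j, k`. -/
def sandwichMatrix (p r : ℍ[ℝ]) : Matrix (Fin 4) (Fin 4) ℝ :=
  LinearMap.toMatrix quaternionBasis quaternionBasis (LinearMap.mulLeftRight ℝ (p, r))

theorem Tmat_conj_kron_quaternionMatrix (p r : ℍ[ℝ]) :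
    Tmat * kron (quaternionMatrix p) (quaternionMatrix r)ᵀ * Tmatᴴ =
      (sandwichMatrix p r).map Complex.ofReal := by
  rw [Tmat_mul_mul_conjTranspose, TmatCore_conjTranspose, quaternionMatrix, quaternionMatrix,
    Matrix.eta_fin_two (Matrix.transpose _), kron_of]
  ext i j
  obtain ⟨h₀, h₁, h₂, h₃⟩ := quaternionBasis_components j
  rw [Matrix.map_apply, sandwichMatrix, LinearMap.toMatrix_apply, quaternionBasis_repr,
    LinearMap.mulLeftRight_apply]
  simp only [Quaternion.re_mul, Quaternion.imI_mul, Quaternion.imJ_mul, Quaternion.imK_mul,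
    h₀, h₁, h₂, h₃]
  fin_cases i <;> fin_cases j <;>
    simp [TmatCore, Complex.ext_iff] <;>
    constructor <;> ring

theorem Quaternion.reflection_orthogonal_singleton_apply {v : ℍ[ℝ]} (hv : v ≠ 0) (x : ℍ[ℝ]) :
    (ℝ ∙ v)ᗮ.reflection x = -(‖v‖⁻¹ • v) * star x * (‖v‖⁻¹ • v) := by
  have hn : ‖v‖ ≠ 0 := norm_ne_zero_iff.mpr hv
  have hsq : v.re ^ 2 + v.imI ^ 2 + v.imJ ^ 2 + v.imK ^ 2 = ‖v‖ ^ 2 := by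
    rw [← Quaternion.normSq_def', Quaternion.normSq_eq_norm_mul_self, sq]
  rw [Submodule.reflection_orthogonal_apply, Submodule.reflection_singleton_apply,
    Quaternion.inner_def, two_smul]
  ext <;> simp <;> field_simp <;> rw [← hsq] <;> ring

/-- Every linear isometry of the quaternions is `x ↦ p * x * r` or `x ↦ p * star x * r` for unit
quaternions `p` and `r`. -/
theorem Quaternion.exists_unit_mul_mul_of_linearIsometryEquiv (φ : ℍ[ℝ] ≃ₗᵢ[ℝ] ℍ[ℝ]) :
    ∃ p r : ℍ[ℝ], ‖p‖ = 1 ∧ ‖r‖ = 1 ∧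
      ((∀ x, φ x = p * x * r) ∨ ∀ x, φ x = p * star x * r) := by
  obtain ⟨l, -, rfl⟩ := φ.reflections_generate_dim
  induction l with
  | nil => exact ⟨1, 1, by simp⟩
  | cons v l ih =>
    obtain ⟨p, r, hp, hr, h⟩ := ih
    rw [List.map_cons, List.prod_cons]
    by_cases hv : v = 0
    · subst hv
      have hrefl : (ℝ ∙ (0 : ℍ[ℝ]))ᗮ.reflection = 1 := by
        ext1 x
        exact Submodule.reflection_mem_subspace_eq_self (by simp)
      rw [hrefl, one_mul]
      exact ⟨p, r, hp, hr, h⟩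
    · have hn : ‖v‖ ≠ 0 := norm_ne_zero_iff.mpr hv
      have hu : ‖‖v‖⁻¹ • v‖ = 1 := by rw [norm_smul, norm_inv, norm_norm, inv_mul_cancel₀ hn]
      refine ⟨-(‖v‖⁻¹ • v) * star r, star p * (‖v‖⁻¹ • v), ?_, ?_, ?_⟩
      · rw [norm_mul, norm_neg, hu, Quaternion.norm_star, hr, one_mul]
      · rw [norm_mul, hu, Quaternion.norm_star, hp, one_mul]
      · refine h.symm.imp (fun h x => ?_) fun h x => ?_ <;>
        · rw [LinearIsometryEquiv.coe_mul, Function.comp_apply,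
            Quaternion.reflection_orthogonal_singleton_apply hv, h]
          simp only [star_mul, star_star, mul_assoc]

theorem norm_toLin_quaternionBasis {O : Matrix (Fin 4) (Fin 4) ℝ} (hO : Oᵀ * O = 1) (x : ℍ[ℝ]) :
    ‖Matrix.toLin quaternionBasis quaternionBasis O x‖ = ‖x‖ := by
  have key (q : ℍ[ℝ]) : ‖q‖ ^ 2 =
      (quaternionBasis.repr q : Fin 4 → ℝ) ⬝ᵥ
        (quaternionBasis.repr q : Fin 4 → ℝ) := by
    rw [sq, ← Quaternion.normSq_eq_norm_mul_self, Quaternion.normSq_def']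
    simp [dotProduct, Fin.sum_univ_four, sq, quaternionBasis_repr]
  rw [← sq_eq_sq₀ (norm_nonneg _) (norm_nonneg _), key, key, Matrix.repr_toLin,
    Matrix.dotProduct_mulVec, Matrix.vecMul_mulVec, hO, Matrix.vecMul_one]

/-- Quaternion conjugation as a real linear map. -/
def quaternionConj : ℍ[ℝ] →ₗ[ℝ] ℍ[ℝ] where
  toFun := star
  map_add' := star_add
  map_smul' := Quaternion.star_smul

theorem toMatrix_quaternionConj :
    LinearMap.toMatrix quaternionBasis quaternionBasis
      quaternionConj = Matrix.diagonal ![1, -1, -1, -1] := by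
  ext i j
  obtain ⟨h₀, h₁, h₂, h₃⟩ := quaternionBasis_components j
  rw [LinearMap.toMatrix_apply, quaternionBasis_repr]
  fin_cases i <;> fin_cases j <;> simp_all [quaternionConj]

theorem det_sandwichMatrix {p r : ℍ[ℝ]} (hp : ‖p‖ = 1) (hr : ‖r‖ = 1) :
    (sandwichMatrix p r).det = 1 := by
  have h := congr_arg Matrix.det (Tmat_conj_kron_quaternionMatrix p r)
  rw [Matrix.det_mul_right_comm, Tmat_mul_conjTranspose, Matrix.one_mul, det_kron,
    Matrix.det_transpose, det_quaternionMatrix hp, det_quaternionMatrix hr] at h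
  apply Complex.ofReal_injective
  exact (RingHom.map_det Complex.ofRealHom _).trans (h.symm.trans (by simp))

theorem transpose_mul_sandwichMatrix {p r : ℍ[ℝ]} (hp : ‖p‖ = 1) (hr : ‖r‖ = 1) :
    (sandwichMatrix p r)ᵀ * sandwichMatrix p r = 1 := by
  apply Matrix.map_injective Complex.ofReal_injective
  have hT : ((sandwichMatrix p r)ᵀ).map Complex.ofReal =
      ((sandwichMatrix p r).map Complex.ofReal)ᴴ := by
    ext i j
    simp
  have hr' : (quaternionMatrix r)ᵀᴴ * (quaternionMatrix r)ᵀ = 1 :=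
    conjTranspose_transpose_mul_transpose (quaternionMatrix_conjTranspose_mul hr)
  calc ((sandwichMatrix p r)ᵀ * sandwichMatrix p r).map Complex.ofReal
      = ((sandwichMatrix p r)ᵀ).map Complex.ofReal * (sandwichMatrix p r).map Complex.ofReal :=
        Matrix.map_mul (f := Complex.ofRealHom)
    _ = Tmat * ((kron (quaternionMatrix p) (quaternionMatrix r)ᵀ)ᴴ *
          kron (quaternionMatrix p) (quaternionMatrix r)ᵀ) * Tmatᴴ := by
        rw [hT, ← Tmat_conj_kron_quaternionMatrix, Tmat_conj_mul]
        simp only [Matrix.conjTranspose_mul, Matrix.conjTranspose_conjTranspose, Matrix.mul_assoc]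
    _ = 1 := by
        rw [kron_conjTranspose, kron_mul_kron, quaternionMatrix_conjTranspose_mul hp, hr',
          kron_one_one, Matrix.mul_one, Tmat_mul_conjTranspose]
    _ = (1 : Matrix (Fin 4) (Fin 4) ℝ).map Complex.ofReal := by simp

theorem exists_sandwichMatrix_eq {O : Matrix (Fin 4) (Fin 4) ℝ} (hO : Oᵀ * O = 1)
    (hdet : O.det = 1) : ∃ p r : ℍ[ℝ], ‖p‖ = 1 ∧ ‖r‖ = 1 ∧ sandwichMatrix p r = O := by
  let f : ℍ[ℝ] →ₗᵢ[ℝ] ℍ[ℝ] :=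
    ⟨Matrix.toLin quaternionBasis quaternionBasis O, norm_toLin_quaternionBasis hO⟩
  obtain ⟨p, r, hp, hr, h⟩ := Quaternion.exists_unit_mul_mul_of_linearIsometryEquiv
    (f.toLinearIsometryEquiv rfl)
  refine ⟨p, r, hp, hr, ?_⟩
  rcases h with h | h
  · have hf : LinearMap.mulLeftRight ℝ (p, r) = Matrix.toLin quaternionBasis quaternionBasis O :=
      LinearMap.ext fun x => (h x).symm
    rw [sandwichMatrix, hf, LinearMap.toMatrix_toLin]
  · have hf : LinearMap.mulLeftRight ℝ (p, r) ∘ₗ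
        quaternionConj = Matrix.toLin quaternionBasis quaternionBasis O :=
      LinearMap.ext fun x => (h x).symm
    have hM : sandwichMatrix p r * Matrix.diagonal ![1, -1, -1, -1] = O := by
      rw [← toMatrix_quaternionConj, sandwichMatrix, ← LinearMap.toMatrix_comp, hf,
        LinearMap.toMatrix_toLin]
    rw [← hM, Matrix.det_mul, det_sandwichMatrix hp hr, Matrix.det_diagonal,
      Fin.prod_univ_four] at hdet
    change (1 : ℝ) * (1 * -1 * -1 * -1) = 1 at hdet
    norm_num at hdet

theorem exists_special_orthogonal_of_unitary {U V : Matrix (Fin 2) (Fin 2) ℂ}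
    (hU : Uᴴ * U = 1) (hV : Vᴴ * V = 1) (hdU : U.det = 1) (hdV : V.det = 1) :
    ∃ O : Matrix (Fin 4) (Fin 4) ℝ, Oᵀ * O = 1 ∧ O.det = 1 ∧
      Tmat * kron U V * Tmatᴴ = O.map Complex.ofReal := by
  obtain ⟨p, hp, rfl⟩ := exists_quaternionMatrix_eq hU hdU
  obtain ⟨r, hr, hrV⟩ := exists_quaternionMatrix_eq
    (conjTranspose_transpose_mul_transpose hV) (V.det_transpose.trans hdV)
  refine ⟨sandwichMatrix p r, transpose_mul_sandwichMatrix hp hr, det_sandwichMatrix hp hr, ?_⟩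
  rw [← Tmat_conj_kron_quaternionMatrix, hrV, Matrix.transpose_transpose]

theorem exists_unitary_of_special_orthogonal {O : Matrix (Fin 4) (Fin 4) ℝ} (hO : Oᵀ * O = 1)
    (hdet : O.det = 1) :
    ∃ U V : Matrix (Fin 2) (Fin 2) ℂ, Uᴴ * U = 1 ∧ Vᴴ * V = 1 ∧ U.det = 1 ∧ V.det = 1 ∧
      Tmat * kron U V * Tmatᴴ = O.map Complex.ofReal := by
  obtain ⟨p, r, hp, hr, rfl⟩ := exists_sandwichMatrix_eq hO hdet
  exact ⟨quaternionMatrix p, (quaternionMatrix r)ᵀ, quaternionMatrix_conjTranspose_mul hp,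
    conjTranspose_transpose_mul_transpose (quaternionMatrix_conjTranspose_mul hr),
    det_quaternionMatrix hp, (Matrix.det_transpose _).trans (det_quaternionMatrix hr),
    Tmat_conj_kron_quaternionMatrix p r⟩

theorem Rmat_act (A₁ A₂ A₃ A₄ : Matrix (Fin 2) (Fin 2) ℂ)
    (ψ : Fin 2 → Fin 2 → Fin 2 → Fin 2 → ℂ) :
    Rmat (act A₁ A₂ A₃ A₄ ψ) =
      Tmat * kron A₁ A₂ * Tmatᴴ * Rmat ψ * (Tmat * kron A₃ᵀ A₄ᵀ * Tmatᴴ) := by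
  rw [Rmat, reshape_act, kron_transpose, Tmat_conj_mul, Tmat_conj_mul, Rmat]

theorem Rmat_injective : Function.Injective Rmat :=
  Tmat_conj_injective.comp reshape_injective

/-- Two four-qubit states are related by determinant-1 local unitaries if and only if
their `R`-matrices lie in the same `SO(4,ℝ)×SO(4,ℝ)` orbit. -/
theorem local_unitary_iff_so4_real_orbit (ψ ψ' : Fin 2 → Fin 2 → Fin 2 → Fin 2 → ℂ) :
    (∃ U₁ U₂ U₃ U₄ : Matrix (Fin 2) (Fin 2) ℂ,
      U₁ᴴ * U₁ = 1 ∧ U₂ᴴ * U₂ = 1 ∧ U₃ᴴ * U₃ = 1 ∧ U₄ᴴ * U₄ = 1 ∧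
      U₁.det = 1 ∧ U₂.det = 1 ∧ U₃.det = 1 ∧ U₄.det = 1 ∧
      ψ' = act U₁ U₂ U₃ U₄ ψ) ↔
    (∃ O₁ O₂ : Matrix (Fin 4) (Fin 4) ℝ,
      O₁ᵀ * O₁ = 1 ∧ O₂ᵀ * O₂ = 1 ∧ O₁.det = 1 ∧ O₂.det = 1 ∧
      Rmat ψ' = O₁.map Complex.ofReal * Rmat ψ * O₂.map Complex.ofReal) := by
  constructor
  · rintro ⟨U₁, U₂, U₃, U₄, h₁, h₂, h₃, h₄, d₁, d₂, d₃, d₄, rfl⟩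
    obtain ⟨O₁, hO₁, hd₁, e₁⟩ := exists_special_orthogonal_of_unitary h₁ h₂ d₁ d₂
    obtain ⟨O₂, hO₂, hd₂, e₂⟩ := exists_special_orthogonal_of_unitary
      (conjTranspose_transpose_mul_transpose h₃) (conjTranspose_transpose_mul_transpose h₄)
      (U₃.det_transpose.trans d₃) (U₄.det_transpose.trans d₄)
    exact ⟨O₁, O₂, hO₁, hO₂, hd₁, hd₂, by rw [Rmat_act, e₁, e₂]⟩
  · rintro ⟨O₁, O₂, hO₁, hO₂, hd₁, hd₂, h⟩
    obtain ⟨U₁, U₂, h₁, h₂, d₁, d₂, e₁⟩ := exists_unitary_of_special_orthogonal hO₁ hd₁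
    obtain ⟨U₃, U₄, h₃, h₄, d₃, d₄, e₂⟩ := exists_unitary_of_special_orthogonal hO₂ hd₂
    refine ⟨U₁, U₂, U₃ᵀ, U₄ᵀ, h₁, h₂, conjTranspose_transpose_mul_transpose h₃,
      conjTranspose_transpose_mul_transpose h₄, d₁, d₂, U₃.det_transpose.trans d₃,
      U₄.det_transpose.trans d₄, Rmat_injective ?_⟩
    rw [h, Rmat_act, Matrix.transpose_transpose, Matrix.transpose_transpose, e₁, e₂]
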